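/- Fix t ∈ ℂ with t ≠ 0, let I'' ⊆ ℂ[x₁,x₂,x₃,x₄] be the ideal generated by (x_i² − t²)x_i for i = 1,…,4, by 2t² − (x₁² + x₂² + x₃² + x₄²), and by x_i x_j x_k for 1 ≤ i < j < k ≤ 4, and let gr I'' be the homogeneous ideal generated by the top-degree homogeneous components of the nonzero elements of I''. Then the socle of the finite-dimensional ℂ-algebra ℂ[x₁,x₂,x₃,x₄]/gr I'' has dimension 2. -/

import Mathlib

open MvPolynomial

/-- The ideal `I'' ⊆ ℂ[x₁,x₂,x₃,x₄]` generated by `(x_i² − t²)x_i` for `i = 1,…,4`, by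
`2t² − (x₁² + x₂² + x₃² + x₄²)`, and by `x_i x_j x_k` for `1 ≤ i < j < k ≤ 4`. -/
noncomputable def idealIpp (t : ℂ) : Ideal (MvPolynomial (Fin 4) ℂ) :=
  Ideal.span
    ((Set.range fun i : Fin 4 =>
        ((X i : MvPolynomial (Fin 4) ℂ) ^ 2 - C (t ^ 2)) * X i)
      ∪ {C (2 * t ^ 2) - (X 0 ^ 2 + X 1 ^ 2 + X 2 ^ 2 + X 3 ^ 2)}
      ∪ {p : MvPolynomial (Fin 4) ℂ |
          ∃ i j k : Fin 4, i < j ∧ j < k ∧ p = X i * X j * X k})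

/-- `gr I''`: the homogeneous ideal generated by the top-degree homogeneous components of the
nonzero elements of `I''`. -/
noncomputable def grIdealIpp (t : ℂ) : Ideal (MvPolynomial (Fin 4) ℂ) :=
  Ideal.span {q : MvPolynomial (Fin 4) ℂ |
    ∃ p ∈ idealIpp t, p ≠ 0 ∧ q = homogeneousComponent p.totalDegree p}

/-- The socle of `ℂ[x₁,x₂,x₃,x₄]/gr I''`: the annihilator of the maximal ideal generated by
the images of `x₁,…,x₄`, as a `ℂ`-subspace of the quotient. -/
noncomputable def socleQuot (t : ℂ) :
    Submodule ℂ (MvPolynomial (Fin 4) ℂ ⧸ grIdealIpp t) where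
  carrier := {a | ∀ i : Fin 4, Ideal.Quotient.mk (grIdealIpp t) (X i) * a = 0}
  add_mem' := by
    intro a b ha hb
    simp only [Set.mem_setOf_eq] at ha hb ⊢
    intro i
    rw [mul_add, ha i, hb i, add_zero]
  zero_mem' := by
    simp only [Set.mem_setOf_eq]
    intro i
    rw [mul_zero]
  smul_mem' := by
    intro c a ha
    simp only [Set.mem_setOf_eq] at ha ⊢
    intro i
    rw [mul_smul_comm, ha i, smul_zero]

/-- The coefficient of `x_i ^ a * x_j ^ b` (for `i ≠ j`) in a polynomial. -/
noncomputable def pairCoeff (p : MvPolynomial (Fin 4) ℂ) (i : Fin 4) (a : ℕ) (j : Fin 4) (b : ℕ) :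
    ℂ :=
  coeff (Finsupp.single i a + Finsupp.single j b) p

lemma pairCoeff_comm (p : MvPolynomial (Fin 4) ℂ) (i : Fin 4) (a : ℕ) (j : Fin 4) (b : ℕ) :
    pairCoeff p i a j b = pairCoeff p j b i a := by
  rw [pairCoeff, pairCoeff, add_comm]

lemma pairCoeff_zero_right (p : MvPolynomial (Fin 4) ℂ) (i : Fin 4) (a : ℕ) (j k : Fin 4) :
    pairCoeff p i a j 0 = pairCoeff p i a k 0 := by
  simp [pairCoeff]

lemma pairCoeff_zero_zero (p : MvPolynomial (Fin 4) ℂ) (i j k l : Fin 4) :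
    pairCoeff p i 0 j 0 = pairCoeff p k 0 l 0 := by
  simp [pairCoeff]

@[simp] lemma pairCoeff_add (p q : MvPolynomial (Fin 4) ℂ) (i : Fin 4) (a : ℕ) (j : Fin 4)
    (b : ℕ) : pairCoeff (p + q) i a j b = pairCoeff p i a j b + pairCoeff q i a j b :=
  coeff_add _ _ _

@[simp] lemma pairCoeff_smul (c : ℂ) (p : MvPolynomial (Fin 4) ℂ) (i : Fin 4) (a : ℕ) (j : Fin 4)
    (b : ℕ) : pairCoeff (c • p) i a j b = c * pairCoeff p i a j b := by
  simp [pairCoeff]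

@[simp] lemma pairCoeff_neg (p : MvPolynomial (Fin 4) ℂ) (i : Fin 4) (a : ℕ) (j : Fin 4)
    (b : ℕ) : pairCoeff (-p) i a j b = -pairCoeff p i a j b :=
  coeff_neg _ _ _

@[simp] lemma pairCoeff_zero (i : Fin 4) (a : ℕ) (j : Fin 4) (b : ℕ) :
    pairCoeff 0 i a j b = 0 := by
  simp [pairCoeff]

lemma pairCoeff_X_mul_left (p : MvPolynomial (Fin 4) ℂ) (i : Fin 4) (a : ℕ) (j : Fin 4) (b : ℕ) :
    pairCoeff (X i * p) i (a + 1) j b = pairCoeff p i a j b := by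
  rw [pairCoeff, pairCoeff, add_comm a, Finsupp.single_add, add_assoc, coeff_X_mul]

lemma pairCoeff_X_mul_right (p : MvPolynomial (Fin 4) ℂ) (i : Fin 4) (a : ℕ) (j : Fin 4)
    (b : ℕ) : pairCoeff (X j * p) i a j (b + 1) = pairCoeff p i a j b := by
  rw [pairCoeff_comm, pairCoeff_X_mul_left, pairCoeff_comm]

lemma pairCoeff_X_mul_eq_zero (p : MvPolynomial (Fin 4) ℂ) {i j k : Fin 4} {a b : ℕ}
    (hi : k ≠ i ∨ a = 0) (hj : k ≠ j ∨ b = 0) : pairCoeff (X k * p) i a j b = 0 := by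
  rw [pairCoeff, coeff_X_mul', if_neg]
  rcases hi with hi | rfl <;> rcases hj with hj | rfl <;>
    simp [*]

/-- The linear conditions on the coefficients of a polynomial that cut out `gr I''`. -/
structure LeadingConditions (p : MvPolynomial (Fin 4) ℂ) : Prop where
  const : ∀ i j, i ≠ j → pairCoeff p i 0 j 0 = 0
  linear : ∀ i j, i ≠ j → pairCoeff p i 1 j 0 = 0
  mixed : ∀ i j, i ≠ j → pairCoeff p i 1 j 1 = 0
  square : ∀ i j k, i ≠ k → j ≠ k → pairCoeff p i 2 k 0 = pairCoeff p j 2 k 0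
  cubic : ∀ i j k, i ≠ j → i ≠ k → pairCoeff p i 1 j 2 = pairCoeff p i 1 k 2
  quartic : ∀ i j k l, i ≠ j → i ≠ k → i ≠ l → j ≠ k → j ≠ l → k ≠ l →
    pairCoeff p i 2 j 2 + pairCoeff p k 2 l 2 = pairCoeff p i 2 k 2 + pairCoeff p j 2 l 2

/-- Conditions of degree at most three, which cut out the preimage of the socle. -/
structure SocleConditions (p : MvPolynomial (Fin 4) ℂ) : Prop where
  const : ∀ i j, i ≠ j → pairCoeff p i 0 j 0 = 0
  linear : ∀ i j, i ≠ j → pairCoeff p i 1 j 0 = 0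
  mixed : ∀ i j, i ≠ j → pairCoeff p i 1 j 1 = 0
  square : ∀ i j k, i ≠ k → j ≠ k → pairCoeff p i 2 k 0 = pairCoeff p j 2 k 0
  cubic : ∀ i j k, i ≠ j → i ≠ k → pairCoeff p i 1 j 2 = pairCoeff p i 1 k 2

lemma LeadingConditions.socleConditions {p : MvPolynomial (Fin 4) ℂ} (h : LeadingConditions p) :
    SocleConditions p :=
  ⟨h.const, h.linear, h.mixed, h.square, h.cubic⟩

lemma exists_ne_pair (i j : Fin 4) : ∃ k, k ≠ i ∧ k ≠ j := by decide +revert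

lemma SocleConditions.X_mul {p : MvPolynomial (Fin 4) ℂ} (h : SocleConditions p) (n : Fin 4) :
    LeadingConditions (X n * p) where
  const i j _ := pairCoeff_X_mul_eq_zero p (.inr rfl) (.inr rfl)
  linear i j hij := by
    by_cases hi : n = i
    · subst hi
      rw [pairCoeff_X_mul_left, h.const _ _ hij]
    · exact pairCoeff_X_mul_eq_zero p (.inl hi) (.inr rfl)
  mixed i j hij := by
    by_cases hi : n = i
    · subst hi
      rw [pairCoeff_X_mul_left, pairCoeff_comm, h.linear _ _ hij.symm]
    by_cases hj : n = j
    · subst hj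
      rw [pairCoeff_X_mul_right, h.linear _ _ hij]
    exact pairCoeff_X_mul_eq_zero p (.inl hi) (.inl hj)
  square := by
    have key : ∀ i k, i ≠ k → pairCoeff (X n * p) i 2 k 0 = 0 := by
      intro i k hik
      by_cases hi : n = i
      · subst hi
        rw [pairCoeff_X_mul_left, h.linear _ _ hik]
      · exact pairCoeff_X_mul_eq_zero p (.inl hi) (.inr rfl)
    intro i j k hik hjk
    rw [key i k hik, key j k hjk]
  cubic i j k hij hik := by
    by_cases hi : n = i
    · subst hi
      rw [pairCoeff_X_mul_left, pairCoeff_X_mul_left, pairCoeff_comm, pairCoeff_comm p n 0 k 2]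
      exact h.square _ _ _ hij.symm hik.symm
    have key : ∀ j, i ≠ j → pairCoeff (X n * p) i 1 j 2 = 0 := by
      intro j hij
      by_cases hj : n = j
      · subst hj
        rw [pairCoeff_X_mul_right, h.mixed _ _ hij]
      · exact pairCoeff_X_mul_eq_zero p (.inl hi) (.inl hj)
    rw [key j hij, key k hik]
  quartic i j k l hij hik hil hjk hjl hkl := by
    have left : ∀ j, n ≠ j → pairCoeff (X n * p) n 2 j 2 = pairCoeff p n 1 j 2 :=
      fun j _ => pairCoeff_X_mul_left p n 1 j 2
    have right : ∀ j, n ≠ j → pairCoeff (X n * p) j 2 n 2 = pairCoeff p n 1 j 2 := by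
      intro j hj
      rw [pairCoeff_comm, left j hj]
    have other : ∀ i j, n ≠ i → n ≠ j → pairCoeff (X n * p) i 2 j 2 = 0 :=
      fun i j hi hj => pairCoeff_X_mul_eq_zero p (.inl hi) (.inl hj)
    have hc := h.cubic n
    have hn : n = i ∨ n = j ∨ n = k ∨ n = l := by
      clear left right other hc
      lia
    rcases hn with rfl | rfl | rfl | rfl
    · rw [left _ hij, left _ hik, other k l hik hil, other j l hij hil, hc _ _ hij hik]
    · rw [right _ hij.symm, left _ hjl, other k l hjk hjl, other i k hij.symm hjk, add_zero,
        zero_add, hc _ _ hij.symm hjl]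
    · rw [left _ hkl, right _ hik.symm, other i j hik.symm hjk.symm, other j l hjk.symm hkl,
        add_zero, zero_add, hc _ _ hkl hik.symm]
    · rw [right _ hkl.symm, right _ hjl.symm, other i j hil.symm hjl.symm,
        other i k hil.symm hkl.symm, hc _ _ hkl.symm hjl.symm]

lemma socleConditions_of_X_mul {p : MvPolynomial (Fin 4) ℂ}
    (h : ∀ n, LeadingConditions (X n * p)) : SocleConditions p where
  const i j hij := by
    rw [← pairCoeff_X_mul_left, (h i).linear i j hij]
  linear i j hij := by
    rw [← pairCoeff_X_mul_right, (h j).mixed i j hij]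
  mixed i j hij := by
    obtain ⟨k, hki, hkj⟩ := exists_ne_pair i j
    rw [← pairCoeff_X_mul_right, (h j).cubic i j k hij hki.symm]
    exact pairCoeff_X_mul_eq_zero p (.inl hij.symm) (.inl hkj.symm)
  square i j k hik hjk := by
    rw [pairCoeff_comm, pairCoeff_comm p j, ← pairCoeff_X_mul_left p k, ← pairCoeff_X_mul_left p k,
      (h k).cubic k i j hik.symm hjk.symm]
  cubic i j k hij hik := by
    by_cases hjk : j = k
    · rw [hjk]
    obtain ⟨l, hli, hlj, hlk⟩ : ∃ l, l ≠ i ∧ l ≠ j ∧ l ≠ k := by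
      clear h
      decide +revert
    have := (h i).quartic i j k l hij hik hli.symm hjk hlj.symm hlk.symm
    rwa [pairCoeff_X_mul_left, pairCoeff_X_mul_left,
      pairCoeff_X_mul_eq_zero p (.inl hik) (.inl hli.symm),
      pairCoeff_X_mul_eq_zero p (.inl hij) (.inl hli.symm), add_zero, add_zero] at this

lemma LeadingConditions.zero : LeadingConditions 0 := by
  constructor <;> simp

lemma LeadingConditions.add {p q : MvPolynomial (Fin 4) ℂ} (hp : LeadingConditions p)
    (hq : LeadingConditions q) : LeadingConditions (p + q) where
  const i j hij := by simp [hp.const i j hij, hq.const i j hij]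
  linear i j hij := by simp [hp.linear i j hij, hq.linear i j hij]
  mixed i j hij := by simp [hp.mixed i j hij, hq.mixed i j hij]
  square i j k hik hjk := by simp [hp.square i j k hik hjk, hq.square i j k hik hjk]
  cubic i j k hij hik := by simp [hp.cubic i j k hij hik, hq.cubic i j k hij hik]
  quartic i j k l hij hik hil hjk hjl hkl := by
    simp only [pairCoeff_add]
    linear_combination hp.quartic i j k l hij hik hil hjk hjl hkl +
      hq.quartic i j k l hij hik hil hjk hjl hkl

lemma LeadingConditions.C_mul {p : MvPolynomial (Fin 4) ℂ} (hp : LeadingConditions p) (c : ℂ) :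
    LeadingConditions (C c * p) := by
  rw [C_mul']
  exact {
    const i j hij := by simp [hp.const i j hij]
    linear i j hij := by simp [hp.linear i j hij]
    mixed i j hij := by simp [hp.mixed i j hij]
    square i j k hik hjk := by simp [hp.square i j k hik hjk]
    cubic i j k hij hik := by simp [hp.cubic i j k hij hik]
    quartic i j k l hij hik hil hjk hjl hkl := by
      simp only [pairCoeff_smul]
      linear_combination c * hp.quartic i j k l hij hik hil hjk hjl hkl }

lemma LeadingConditions.mul {p : MvPolynomial (Fin 4) ℂ} (hp : LeadingConditions p)
    (q : MvPolynomial (Fin 4) ℂ) : LeadingConditions (q * p) := by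
  induction q using MvPolynomial.induction_on with
  | C c => exact hp.C_mul c
  | add q r hq hr =>
    rw [add_mul]
    exact hq.add hr
  | mul_X q n hq =>
    rw [mul_comm q, mul_assoc]
    exact hq.socleConditions.X_mul n

lemma sum_support_eq_sum {M : Type*} [AddCommMonoid M] (p : MvPolynomial (Fin 4) ℂ)
    (s : Finset (Fin 4 →₀ ℕ)) (f : (Fin 4 →₀ ℕ) → M)
    (hs : ∀ m ∈ p.support, m ∉ s → f m = 0) (hf : ∀ m, coeff m p = 0 → f m = 0) :
    ∑ m ∈ p.support, f m = ∑ m ∈ s, f m :=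
  Finset.sum_congr_of_eq_on_inter hs (fun m _ hm => hf m (notMem_support_iff.mp hm))
    fun _ _ _ => rfl

/-- The point `a e_i + b e_j` (for `i ≠ j`). -/
def pairPoint (i j : Fin 4) (a b : ℂ) : Fin 4 → ℂ :=
  fun n => if n = i then a else if n = j then b else 0

lemma eval_pairPoint {p : MvPolynomial (Fin 4) ℂ} {N : ℕ} (hp : p.totalDegree < N) {i j : Fin 4}
    (hij : i ≠ j) (a b : ℂ) :
    eval (pairPoint i j a b) p =
      ∑ k ∈ Finset.range N, ∑ l ∈ Finset.range N, pairCoeff p i k j l * (a ^ k * b ^ l) := by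
  have hinj : Function.Injective fun x : ℕ × ℕ =>
      (Finsupp.single i x.1 + Finsupp.single j x.2 : Fin 4 →₀ ℕ) := by
    intro x y h
    have hi := DFunLike.congr_fun h i
    have hj := DFunLike.congr_fun h j
    simp [hij, hij.symm] at hi hj
    exact Prod.ext hi hj
  rw [eval_eq', sum_support_eq_sum p
    ((Finset.range N ×ˢ Finset.range N).map ⟨_, hinj⟩), Finset.sum_map, Finset.sum_product]
  · refine Finset.sum_congr rfl fun k _ => Finset.sum_congr rfl fun l _ => ?_
    rw [pairCoeff]
    congr 1
    rw [← Finset.prod_subset (Finset.subset_univ {i, j}), Finset.prod_pair hij]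
    · simp [pairPoint, hij, hij.symm]
    · intro n _ hn
      simp only [Finset.mem_insert, Finset.mem_singleton, not_or] at hn
      simp [Ne.symm hn.1, Ne.symm hn.2]
  · intro m hm hms
    obtain ⟨n, hni, hnj, hn⟩ : ∃ n, n ≠ i ∧ n ≠ j ∧ m n ≠ 0 := by
      by_contra! hcon
      refine hms ?_
      have hle : ∀ n, m n < N := fun n =>
        (Finsupp.le_degree n m).trans_lt ((le_totalDegree hm).trans_lt hp)
      refine Finset.mem_map.mpr ⟨(m i, m j), by simp [hle], ?_⟩
      ext n
      by_cases hi : n = i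
      · subst hi
        simp [hij]
      by_cases hj : n = j
      · subst hj
        simp [hij]
      simp [hcon n hi hj, Ne.symm hi, Ne.symm hj]
    rw [Finset.prod_eq_zero (Finset.mem_univ n), mul_zero]
    simp [pairPoint, hni, hnj, hn]
  · intro m hm
    rw [hm, zero_mul]

lemma eval_pairPoint_of_mem {t : ℂ} {p : MvPolynomial (Fin 4) ℂ} (hp : p ∈ idealIpp t)
    {i j : Fin 4} (hij : i ≠ j) {a b : ℂ} (ha : a ^ 2 = t ^ 2) (hb : b ^ 2 = t ^ 2) :
    eval (pairPoint i j a b) p = 0 := by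
  rw [← RingHom.mem_ker]
  refine (Ideal.span_le.mpr ?_ : idealIpp t ≤ _) hp
  rintro q ((⟨n, rfl⟩ | rfl) | ⟨k, l, n, hkl, hln, rfl⟩)
  · rw [SetLike.mem_coe, RingHom.mem_ker]
    simp only [map_mul, map_sub, map_pow, eval_X, eval_C, pairPoint]
    split_ifs <;> simp [*]
  · rw [SetLike.mem_coe, RingHom.mem_ker]
    have key : ∑ n, pairPoint i j a b n ^ 2 = a ^ 2 + b ^ 2 := by
      rw [← Finset.sum_subset (Finset.subset_univ {i, j}), Finset.sum_pair hij]
      · simp [pairPoint, hij.symm]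
      · intro n _ hn
        simp only [Finset.mem_insert, Finset.mem_singleton, not_or] at hn
        simp [pairPoint, hn]
    rw [Fin.sum_univ_four, ha, hb] at key
    simp only [map_sub, map_add, map_pow, eval_X, eval_C]
    linear_combination -key
  · rw [SetLike.mem_coe, RingHom.mem_ker]
    simp only [map_mul, eval_X, pairPoint]
    have hk : (k ≠ i ∧ k ≠ j) ∨ (l ≠ i ∧ l ≠ j) ∨ (n ≠ i ∧ n ≠ j) := by lia
    rcases hk with h | h | h <;> simp [h]

lemma pairCoeff_eq_zero {p : MvPolynomial (Fin 4) ℂ} {i j : Fin 4} {a b : ℕ}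
    (h : p.totalDegree < a + b) : pairCoeff p i a j b = 0 := by
  by_contra hne
  have := le_totalDegree (mem_support_iff.mpr hne)
  change Finsupp.degree _ ≤ _ at this
  simp only [map_add, Finsupp.degree_single] at this
  lia

lemma pairCoeff_homogeneousComponent (p : MvPolynomial (Fin 4) ℂ) (d : ℕ) (i j : Fin 4) (a b : ℕ) :
    pairCoeff (homogeneousComponent d p) i a j b = if a + b = d then pairCoeff p i a j b else 0 := by
  rw [pairCoeff, coeff_homogeneousComponent, map_add, Finsupp.degree_single, Finsupp.degree_single,
    pairCoeff]

/-- The relations among the coefficients of a quartic polynomial vanishing at the points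
`± t e_i ± t e_j`, separated by parity. -/
lemma relations_of_mem {t : ℂ} (ht : t ≠ 0) {p : MvPolynomial (Fin 4) ℂ} (hp : p ∈ idealIpp t)
    (hd : p.totalDegree < 5) {i j : Fin 4} (hij : i ≠ j) :
    pairCoeff p i 0 j 0 + (pairCoeff p i 2 j 0 + pairCoeff p i 0 j 2) * t ^ 2 +
        (pairCoeff p i 4 j 0 + pairCoeff p i 2 j 2 + pairCoeff p i 0 j 4) * t ^ 4 = 0 ∧
      pairCoeff p i 1 j 0 + (pairCoeff p i 3 j 0 + pairCoeff p i 1 j 2) * t ^ 2 = 0 ∧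
      pairCoeff p i 1 j 1 + (pairCoeff p i 3 j 1 + pairCoeff p i 1 j 3) * t ^ 2 = 0 := by
  have hz : ∀ a b, 4 < a + b → pairCoeff p i a j b = 0 := fun a b h =>
    pairCoeff_eq_zero (by lia)
  have h1 := eval_pairPoint_of_mem hp hij (a := t) (b := t) rfl rfl
  have h2 := eval_pairPoint_of_mem hp hij (a := t) (b := -t) rfl (by ring)
  have h3 := eval_pairPoint_of_mem hp hij (a := -t) (b := t) (by ring) rfl
  have h4 := eval_pairPoint_of_mem hp hij (a := -t) (b := -t) (by ring) (by ring)
  rw [eval_pairPoint hd hij] at h1 h2 h3 h4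
  simp only [Finset.sum_range_succ, Finset.sum_range_zero] at h1 h2 h3 h4
  simp only [hz 1 4 (by lia), hz 2 3 (by lia), hz 2 4 (by lia), hz 3 2 (by lia), hz 3 3 (by lia),
    hz 3 4 (by lia), hz 4 1 (by lia), hz 4 2 (by lia), hz 4 3 (by lia), hz 4 4 (by lia)]
    at h1 h2 h3 h4
  refine ⟨?_, ?_, ?_⟩
  · linear_combination (h1 + h2 + h3 + h4) / 4
  · refine mul_left_cancel₀ ht ?_
    linear_combination (h1 + h2 - h3 - h4) / 4
  · refine mul_left_cancel₀ (pow_ne_zero 2 ht) ?_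
    linear_combination (h1 - h2 - h3 + h4) / 4

lemma leadingConditions_homogeneousComponent {t : ℂ} (ht : t ≠ 0) {p : MvPolynomial (Fin 4) ℂ}
    (hp : p ∈ idealIpp t) : LeadingConditions (homogeneousComponent p.totalDegree p) := by
  have hrel : p.totalDegree < 5 → _ := fun hd i j hij =>
    relations_of_mem ht hp hd (i := i) (j := j) hij
  have ht2 := pow_ne_zero 2 ht
  have ht4 := pow_ne_zero 4 ht
  have hz : ∀ i j a b, p.totalDegree < a + b → pairCoeff p i a j b = 0 := fun i j a b h =>
    pairCoeff_eq_zero h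
  constructor
  · intro i j hij
    rw [pairCoeff_homogeneousComponent, ite_eq_right_iff]
    intro hd
    have := (hrel (by lia) i j hij).1
    simpa [hz i j 2 0 (by lia), hz i j 0 2 (by lia), hz i j 4 0 (by lia), hz i j 2 2 (by lia),
      hz i j 0 4 (by lia)] using this
  · intro i j hij
    rw [pairCoeff_homogeneousComponent, ite_eq_right_iff]
    intro hd
    have := (hrel (by lia) i j hij).2.1
    simpa [hz i j 3 0 (by lia), hz i j 1 2 (by lia)] using this
  · intro i j hij
    rw [pairCoeff_homogeneousComponent, ite_eq_right_iff]
    intro hd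
    have := (hrel (by lia) i j hij).2.2
    simpa [hz i j 3 1 (by lia), hz i j 1 3 (by lia)] using this
  · intro i j k hik hjk
    rw [pairCoeff_homogeneousComponent, pairCoeff_homogeneousComponent]
    split_ifs with hd
    · by_cases hij : i = j
      · rw [hij]
      have h1 := (hrel (by lia) i k hik).1
      have h2 := (hrel (by lia) j k hjk).1
      simp only [hz _ _ 4 0 (by lia), hz _ _ 2 2 (by lia), hz _ _ 0 4 (by lia)] at h1 h2
      rw [pairCoeff_zero_zero p j k i k, pairCoeff_comm p j 0, pairCoeff_zero_right p k 2 j i,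
        pairCoeff_comm p k 2] at h2
      refine mul_right_cancel₀ ht2 ?_
      linear_combination h1 - h2
    · rfl
  · intro i j k hij hik
    rw [pairCoeff_homogeneousComponent, pairCoeff_homogeneousComponent]
    split_ifs with hd
    · have h1 := (hrel (by lia) i j hij).2.1
      have h2 := (hrel (by lia) i k hik).2.1
      rw [pairCoeff_zero_right p i 1 k j, pairCoeff_zero_right p i 3 k j] at h2
      refine mul_right_cancel₀ ht2 ?_
      linear_combination h1 - h2
    · rfl
  · intro i j k l hij hik hil hjk hjl hkl
    simp only [pairCoeff_homogeneousComponent]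
    split_ifs with hd
    · have h1 := (hrel (by lia) i j hij).1
      have h2 := (hrel (by lia) k l hkl).1
      have h3 := (hrel (by lia) i k hik).1
      have h4 := (hrel (by lia) j l hjl).1
      refine mul_right_cancel₀ ht4 ?_
      simp only [pairCoeff, Finsupp.single_zero, add_zero, zero_add] at h1 h2 h3 h4 ⊢
      linear_combination h1 + h2 - h3 - h4
    · rfl

lemma leadingConditions_of_mem {t : ℂ} (ht : t ≠ 0) {q : MvPolynomial (Fin 4) ℂ}
    (hq : q ∈ grIdealIpp t) : LeadingConditions q := by
  refine Submodule.span_induction ?_ .zero (fun _ _ _ _ hx hy => hx.add hy)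
    (fun a _ _ hx => hx.mul a) hq
  rintro _ ⟨p, hp, -, rfl⟩
  exact leadingConditions_homogeneousComponent ht hp

lemma mem_grIdealIpp_of_add_mem {t : ℂ} {q r : MvPolynomial (Fin 4) ℂ} {d : ℕ}
    (hq : q.IsHomogeneous d) (hr : r.totalDegree < d) (h : q + r ∈ idealIpp t) :
    q ∈ grIdealIpp t := by
  by_cases hq0 : q = 0
  · rw [hq0]
    exact zero_mem _
  have hdeg : (q + r).totalDegree = d := by
    rw [totalDegree_add_eq_left_of_totalDegree_lt (by rwa [hq.totalDegree hq0]),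
      hq.totalDegree hq0]
  refine Ideal.subset_span ⟨q + r, h, ?_, ?_⟩
  · intro h0
    rw [h0, totalDegree_zero] at hdeg
    lia
  · rw [hdeg, map_add, homogeneousComponent_of_mem hq, if_pos rfl,
      homogeneousComponent_eq_zero _ _ hr, add_zero]

lemma X_pow_three_mem (t : ℂ) (i : Fin 4) : (X i ^ 3 : MvPolynomial (Fin 4) ℂ) ∈ grIdealIpp t := by
  refine mem_grIdealIpp_of_add_mem (d := 3) (r := C (-t ^ 2) * X i) (isHomogeneous_X_pow i 3) ?_ ?_
  · refine (totalDegree_mul _ _).trans_lt ?_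
    rw [totalDegree_C, totalDegree_X]
    norm_num
  · refine Ideal.subset_span (.inl (.inl ⟨i, ?_⟩))
    simp only [map_neg]
    ring

lemma sum_X_sq_mem (t : ℂ) :
    (X 0 ^ 2 + X 1 ^ 2 + X 2 ^ 2 + X 3 ^ 2 : MvPolynomial (Fin 4) ℂ) ∈ grIdealIpp t := by
  refine mem_grIdealIpp_of_add_mem (d := 2) (r := C (-(2 * t ^ 2)))
    ((((isHomogeneous_X_pow 0 2).add (isHomogeneous_X_pow 1 2)).add (isHomogeneous_X_pow 2 2)).add
      (isHomogeneous_X_pow 3 2)) ?_ ?_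
  · rw [totalDegree_C]
    norm_num
  · rw [← neg_mem_iff]
    refine Ideal.subset_span (.inl (.inr ?_))
    simp only [map_neg, Set.mem_singleton_iff]
    ring

lemma X_mul_X_mul_X_mem (t : ℂ) {i j k : Fin 4} (hij : i < j) (hjk : j < k) :
    (X i * X j * X k : MvPolynomial (Fin 4) ℂ) ∈ grIdealIpp t := by
  refine mem_grIdealIpp_of_add_mem (d := 3) (r := 0)
    (((isHomogeneous_X ℂ i).mul (isHomogeneous_X ℂ j)).mul (isHomogeneous_X ℂ k)) ?_ ?_
  · rw [totalDegree_zero]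
    norm_num
  · rw [add_zero]
    exact Ideal.subset_span (.inr ⟨i, j, k, hij, hjk, rfl⟩)

/-- The exponents of the monomials involving at most two variables, each at most squared. -/
def standardExponents : List (ℕ × ℕ × ℕ × ℕ) :=
  [(0, 0, 0, 0), (1, 0, 0, 0), (0, 1, 0, 0), (0, 0, 1, 0), (0, 0, 0, 1),
    (2, 0, 0, 0), (0, 2, 0, 0), (0, 0, 2, 0), (0, 0, 0, 2),
    (1, 1, 0, 0), (1, 0, 1, 0), (1, 0, 0, 1), (0, 1, 1, 0), (0, 1, 0, 1), (0, 0, 1, 1),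
    (1, 2, 0, 0), (1, 0, 2, 0), (1, 0, 0, 2), (0, 1, 2, 0), (0, 1, 0, 2), (0, 0, 1, 2),
    (2, 1, 0, 0), (2, 0, 1, 0), (2, 0, 0, 1), (0, 2, 1, 0), (0, 2, 0, 1), (0, 0, 2, 1),
    (2, 2, 0, 0), (2, 0, 2, 0), (2, 0, 0, 2), (0, 2, 2, 0), (0, 2, 0, 2), (0, 0, 2, 2)]

lemma standardExponents_nodup : standardExponents.Nodup := by decide

/-- The exponent with the given components. -/
noncomputable def exponentOfTuple (x : ℕ × ℕ × ℕ × ℕ) : Fin 4 →₀ ℕ :=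
  Finsupp.single 0 x.1 + Finsupp.single 1 x.2.1 + Finsupp.single 2 x.2.2.1 +
    Finsupp.single 3 x.2.2.2

lemma exponentOfTuple_apply (m : Fin 4 →₀ ℕ) : exponentOfTuple (m 0, m 1, m 2, m 3) = m := by
  ext i
  fin_cases i <;> simp [exponentOfTuple]

lemma exponentOfTuple_injective : Function.Injective exponentOfTuple := by
  rintro ⟨a, b, c, d⟩ ⟨a', b', c', d'⟩ h
  have h0 := DFunLike.congr_fun h 0
  have h1 := DFunLike.congr_fun h 1
  have h2 := DFunLike.congr_fun h 2
  have h3 := DFunLike.congr_fun h 3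
  simp [exponentOfTuple] at h0 h1 h2 h3
  simp [*]

lemma mem_standardExponents {a b c d : ℕ} (h : (a, b, c, d) ∉ standardExponents) :
    3 ≤ a ∨ 3 ≤ b ∨ 3 ≤ c ∨ 3 ≤ d ∨ (0 < a ∧ 0 < b ∧ 0 < c) ∨ (0 < a ∧ 0 < b ∧ 0 < d) ∨
      (0 < a ∧ 0 < c ∧ 0 < d) ∨ (0 < b ∧ 0 < c ∧ 0 < d) := by
  by_cases ha : 3 ≤ a
  · exact .inl ha
  by_cases hb : 3 ≤ b
  · exact .inr (.inl hb)
  by_cases hc : 3 ≤ c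
  · exact .inr (.inr (.inl hc))
  by_cases hd : 3 ≤ d
  · exact .inr (.inr (.inr (.inl hd)))
  have key : ∀ a b c d : Fin 3, (a.val, b.val, c.val, d.val) ∉ standardExponents →
      (0 < a.val ∧ 0 < b.val ∧ 0 < c.val) ∨ (0 < a.val ∧ 0 < b.val ∧ 0 < d.val) ∨
      (0 < a.val ∧ 0 < c.val ∧ 0 < d.val) ∨ (0 < b.val ∧ 0 < c.val ∧ 0 < d.val) := by decide
  exact .inr (.inr (.inr (.inr
    (key ⟨a, by lia⟩ ⟨b, by lia⟩ ⟨c, by lia⟩ ⟨d, by lia⟩ h))))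

lemma monomial_eq_prod (m : Fin 4 →₀ ℕ) (c : ℂ) :
    monomial m c = C c * (X 0 ^ m 0 * X 1 ^ m 1 * X 2 ^ m 2 * X 3 ^ m 3) := by
  rw [monomial_eq, Finsupp.prod_fintype _ _ (by simp), Fin.prod_univ_four]

lemma monomial_mem_grIdealIpp (t : ℂ) {m : Fin 4 →₀ ℕ}
    (hm : (m 0, m 1, m 2, m 3) ∉ standardExponents) (c : ℂ) :
    monomial m c ∈ grIdealIpp t := by
  have hpow : ∀ i, 3 ≤ m i → monomial m c ∈ grIdealIpp t := by
    intro i hi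
    refine Ideal.mem_of_dvd _ ?_ (X_pow_three_mem t i)
    rw [X_pow_eq_monomial, monomial_dvd_monomial]
    simp [hi]
  have hprod : ∀ i j k, i < j → j < k → 0 < m i ∧ 0 < m j ∧ 0 < m k →
      monomial m c ∈ grIdealIpp t := by
    rintro i j k hij hjk ⟨hi, hj, hk⟩
    refine Ideal.mem_of_dvd _ ?_ (X_mul_X_mul_X_mem t hij hjk)
    rw [X, X, X, monomial_mul, monomial_mul, monomial_dvd_monomial]
    refine ⟨.inr ?_, by simp⟩
    intro n
    simp only [Finsupp.add_apply, Finsupp.single_apply]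
    split_ifs <;> lia
  rcases mem_standardExponents hm with h | h | h | h | h | h | h | h
  · exact hpow 0 h
  · exact hpow 1 h
  · exact hpow 2 h
  · exact hpow 3 h
  · exact hprod 0 1 2 (by decide) (by decide) h
  · exact hprod 0 1 3 (by decide) (by decide) h
  · exact hprod 0 2 3 (by decide) (by decide) h
  · exact hprod 1 2 3 (by decide) (by decide) h

/-- Modulo `gr I''`, a polynomial is the sum of its terms with standard exponents. -/
lemma mem_grIdealIpp_iff_sum_standard (t : ℂ) (p : MvPolynomial (Fin 4) ℂ) :
    p ∈ grIdealIpp t ↔ (standardExponents.map fun x =>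
      monomial (exponentOfTuple x) (coeff (exponentOfTuple x) p)).sum ∈ grIdealIpp t := by
  rw [← Ideal.Quotient.eq_zero_iff_mem, ← Ideal.Quotient.eq_zero_iff_mem]
  have hsum : Ideal.Quotient.mk (grIdealIpp t) p =
      ∑ m ∈ p.support, Ideal.Quotient.mk (grIdealIpp t) (monomial m (coeff m p)) := by
    rw [← map_sum, ← as_sum]
  rw [hsum, sum_support_eq_sum p (standardExponents.toFinset.map ⟨_, exponentOfTuple_injective⟩),
    Finset.sum_map, ← map_sum, List.sum_toFinset _ standardExponents_nodup]
  · rfl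
  · intro m _ hm
    rw [Ideal.Quotient.eq_zero_iff_mem]
    refine monomial_mem_grIdealIpp t (fun h => hm ?_) _
    exact Finset.mem_map.mpr ⟨_, List.mem_toFinset.mpr h, exponentOfTuple_apply m⟩
  · intro m hm
    simp [hm]

lemma mem_of_leadingConditions (t : ℂ) {p : MvPolynomial (Fin 4) ℂ} (hp : LeadingConditions p) :
    p ∈ grIdealIpp t := by
  rw [mem_grIdealIpp_iff_sum_standard]
  have hconst := hp.const 0 1 (by decide)
  have hlin : ∀ i, coeff (Finsupp.single i 1) p = 0 := by
    intro i
    obtain ⟨j, hj, -⟩ := exists_ne_pair i i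
    simpa [pairCoeff] using hp.linear i j hj.symm
  have hmixed : ∀ i j, i ≠ j → coeff (Finsupp.single i 1 + Finsupp.single j 1) p = 0 := hp.mixed
  obtain ⟨c, hc⟩ : ∃ c, ∀ i, coeff (Finsupp.single i 2) p = c := by
    refine ⟨coeff (Finsupp.single 0 2) p, fun i => ?_⟩
    obtain ⟨j, hj, hj0⟩ := exists_ne_pair i 0
    simpa [pairCoeff] using hp.square i 0 j hj.symm hj0.symm
  have hcubic : ∀ i, ∃ α, ∀ j, i ≠ j → coeff (Finsupp.single i 1 + Finsupp.single j 2) p = α := by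
    intro i
    obtain ⟨j, hj, -⟩ := exists_ne_pair i i
    exact ⟨_, fun k hk => hp.cubic i k j hk hj.symm⟩
  choose α hα using hcubic
  have hα' : ∀ i j, i ≠ j → coeff (Finsupp.single j 2 + Finsupp.single i 1) p = α i := by
    intro i j hij
    rw [add_comm, hα i j hij]
  obtain ⟨b0, b1, b2, b3, h01, h02, h03, h12, h13, h23⟩ : ∃ b0 b1 b2 b3 : ℂ,
      pairCoeff p 0 2 1 2 = b0 + b1 ∧ pairCoeff p 0 2 2 2 = b0 + b2 ∧
      pairCoeff p 0 2 3 2 = b0 + b3 ∧ pairCoeff p 1 2 2 2 = b1 + b2 ∧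
      pairCoeff p 1 2 3 2 = b1 + b3 ∧ pairCoeff p 2 2 3 2 = b2 + b3 := by
    have h1 := hp.quartic 0 1 2 3 (by decide) (by decide) (by decide) (by decide) (by decide)
      (by decide)
    have h2 := hp.quartic 0 1 3 2 (by decide) (by decide) (by decide) (by decide) (by decide)
      (by decide)
    rw [pairCoeff_comm p 3 2 2 2] at h2
    refine ⟨(pairCoeff p 0 2 1 2 + pairCoeff p 0 2 2 2 - pairCoeff p 1 2 2 2) / 2,
      (pairCoeff p 0 2 1 2 + pairCoeff p 1 2 2 2 - pairCoeff p 0 2 2 2) / 2,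
      (pairCoeff p 0 2 2 2 + pairCoeff p 1 2 2 2 - pairCoeff p 0 2 1 2) / 2,
      pairCoeff p 0 2 3 2 -
        (pairCoeff p 0 2 1 2 + pairCoeff p 0 2 2 2 - pairCoeff p 1 2 2 2) / 2,
      ?_, ?_, ?_, ?_, ?_, ?_⟩ <;> first | ring1 | linear_combination h2 | linear_combination h2 - h1
  simp only [pairCoeff, Finsupp.single_zero, add_zero] at hconst h01 h02 h03 h12 h13 h23
  simp only [standardExponents, exponentOfTuple, List.map_cons, List.map_nil, List.sum_cons,
    List.sum_nil, Finsupp.single_zero, add_zero, zero_add]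
  simp only [hconst, hlin, hc, hmixed, hα, hα', h01, h02, h03, h12, h13, h23, ne_eq,
    Fin.reduceEq, not_false_eq_true, monomial_zero, zero_add]
  have hS := sum_X_sq_mem t
  have hX := X_pow_three_mem t
  have key := sub_mem ((grIdealIpp t).mul_mem_left (C c + ∑ i, C (α i) * X i +
      (C b0 * X 0 ^ 2 + C b1 * X 1 ^ 2 + C b2 * X 2 ^ 2 + C b3 * X 3 ^ 2)) hS)
    (add_mem (Ideal.sum_mem _ (t := Finset.univ) fun i _ => (grIdealIpp t).mul_mem_left (C (α i)) (hX i))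
      (add_mem (add_mem (add_mem ((grIdealIpp t).mul_mem_left (C b0 * X 0) (hX 0))
        ((grIdealIpp t).mul_mem_left (C b1 * X 1) (hX 1)))
        ((grIdealIpp t).mul_mem_left (C b2 * X 2) (hX 2)))
        ((grIdealIpp t).mul_mem_left (C b3 * X 3) (hX 3))))
  convert key using 1
  simp only [monomial_eq_prod, Fin.sum_univ_four]
  simp
  ring

lemma mem_grIdealIpp_iff {t : ℂ} (ht : t ≠ 0) {p : MvPolynomial (Fin 4) ℂ} :
    p ∈ grIdealIpp t ↔ LeadingConditions p :=
  ⟨leadingConditions_of_mem ht, mem_of_leadingConditions t⟩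

lemma mk_mem_socleQuot_iff {t : ℂ} (ht : t ≠ 0) {p : MvPolynomial (Fin 4) ℂ} :
    Ideal.Quotient.mk (grIdealIpp t) p ∈ socleQuot t ↔ SocleConditions p := by
  change (∀ i, _ = _) ↔ _
  simp only [← map_mul, Ideal.Quotient.eq_zero_iff_mem, mem_grIdealIpp_iff ht]
  exact ⟨socleConditions_of_X_mul, fun h n => h.X_mul n⟩

lemma pairCoeff_sq_mul_sq {k l : Fin 4} (i : Fin 4) (a : ℕ) (j : Fin 4) (b : ℕ) :
    pairCoeff (X k ^ 2 * X l ^ 2) i a j b =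
      if (Finsupp.single k 2 + Finsupp.single l 2 : Fin 4 →₀ ℕ) =
        Finsupp.single i a + Finsupp.single j b then 1 else 0 := by
  rw [pairCoeff, X_pow_eq_monomial, X_pow_eq_monomial, monomial_mul, coeff_monomial, one_mul]

lemma pairCoeff_sq_mul_sq_of_ne {k l i j : Fin 4} {a b : ℕ} (h : a + b ≠ 4) :
    pairCoeff (X k ^ 2 * X l ^ 2) i a j b = 0 := by
  rw [pairCoeff_sq_mul_sq, if_neg]
  intro hm
  have := congrArg Finsupp.degree hm
  simp only [map_add, Finsupp.degree_single] at this
  lia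

lemma pairCoeff_sq_mul_sq_two {k l i j : Fin 4} (hij : i ≠ j) (hkl : k ≠ l) :
    pairCoeff (X k ^ 2 * X l ^ 2) i 2 j 2 =
      if (k = i ∧ l = j) ∨ (k = j ∧ l = i) then 1 else 0 := by
  rw [pairCoeff_sq_mul_sq]
  refine if_congr ⟨fun h => ?_, ?_⟩ rfl rfl
  · have hk := DFunLike.congr_fun h k
    have hl := DFunLike.congr_fun h l
    simp only [Finsupp.add_apply, Finsupp.single_apply] at hk hl
    grind
  · rintro (⟨rfl, rfl⟩ | ⟨rfl, rfl⟩)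
    · rfl
    · exact add_comm _ _

lemma socleConditions_sq_mul_sq (k l : Fin 4) : SocleConditions (X k ^ 2 * X l ^ 2) := by
  constructor <;> intros <;> simp [pairCoeff_sq_mul_sq_of_ne]

/-- The quartic conditions need only be checked on one pair of independent ones. -/
lemma SocleConditions.leadingConditions {p : MvPolynomial (Fin 4) ℂ} (h : SocleConditions p)
    (h1 : pairCoeff p 0 2 1 2 + pairCoeff p 2 2 3 2 = pairCoeff p 0 2 3 2 + pairCoeff p 1 2 2 2)
    (h2 : pairCoeff p 0 2 2 2 + pairCoeff p 1 2 3 2 = pairCoeff p 0 2 3 2 + pairCoeff p 1 2 2 2) :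
    LeadingConditions p := by
  refine ⟨h.const, h.linear, h.mixed, h.square, h.cubic, ?_⟩
  intro i j k l hij hik hil hjk hjl hkl
  have c10 := pairCoeff_comm p 1 2 0 2
  have c20 := pairCoeff_comm p 2 2 0 2
  have c30 := pairCoeff_comm p 3 2 0 2
  have c21 := pairCoeff_comm p 2 2 1 2
  have c31 := pairCoeff_comm p 3 2 1 2
  have c32 := pairCoeff_comm p 3 2 2 2
  fin_cases i <;> fin_cases j <;> first | exact absurd rfl hij | skip
  all_goals fin_cases k <;> first | exact absurd rfl hik | exact absurd rfl hjk | skip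
  all_goals fin_cases l <;>
    first | exact absurd rfl hil | exact absurd rfl hjl | exact absurd rfl hkl | skip
  all_goals
    simp only [Fin.zero_eta, Fin.mk_one, Fin.reduceFinMk, c10, c20, c30, c21, c31, c32]
    grind

lemma SocleConditions.add {p q : MvPolynomial (Fin 4) ℂ} (hp : SocleConditions p)
    (hq : SocleConditions q) : SocleConditions (p + q) where
  const i j hij := by simp [hp.const i j hij, hq.const i j hij]
  linear i j hij := by simp [hp.linear i j hij, hq.linear i j hij]
  mixed i j hij := by simp [hp.mixed i j hij, hq.mixed i j hij]
  square i j k hik hjk := by simp [hp.square i j k hik hjk, hq.square i j k hik hjk]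
  cubic i j k hij hik := by simp [hp.cubic i j k hij hik, hq.cubic i j k hij hik]

lemma SocleConditions.smul {p : MvPolynomial (Fin 4) ℂ} (hp : SocleConditions p) (c : ℂ) :
    SocleConditions (c • p) where
  const i j hij := by simp [hp.const i j hij]
  linear i j hij := by simp [hp.linear i j hij]
  mixed i j hij := by simp [hp.mixed i j hij]
  square i j k hik hjk := by simp [hp.square i j k hik hjk]
  cubic i j k hij hik := by simp [hp.cubic i j k hij hik]

lemma leadingConditions_sub_iff {p : MvPolynomial (Fin 4) ℂ} (hp : SocleConditions p) (a b : ℂ) :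
    LeadingConditions (a • (X 0 ^ 2 * X 1 ^ 2) + b • (X 0 ^ 2 * X 2 ^ 2) + (-1 : ℂ) • p) ↔
      a = pairCoeff p 0 2 1 2 + pairCoeff p 2 2 3 2 - pairCoeff p 0 2 3 2 - pairCoeff p 1 2 2 2 ∧
      b = pairCoeff p 0 2 2 2 + pairCoeff p 1 2 3 2 - pairCoeff p 0 2 3 2 -
        pairCoeff p 1 2 2 2 := by
  constructor
  · intro h
    have h1 := h.quartic 0 1 3 2 (by decide) (by decide) (by decide) (by decide) (by decide)
      (by decide)
    have h2 := h.quartic 0 2 3 1 (by decide) (by decide) (by decide) (by decide) (by decide)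
      (by decide)
    rw [pairCoeff_comm _ 3 2] at h1 h2
    rw [pairCoeff_comm _ 2 2 1 2] at h2
    simp [pairCoeff_sq_mul_sq_two] at h1 h2
    exact ⟨by linear_combination h1, by linear_combination h2⟩
  · rintro ⟨ha, hb⟩
    refine ((((socleConditions_sq_mul_sq 0 1).smul a).add
      ((socleConditions_sq_mul_sq 0 2).smul b)).add (hp.smul (-1))).leadingConditions ?_ ?_
    · simp [pairCoeff_sq_mul_sq_two]
      linear_combination ha
    · simp [pairCoeff_sq_mul_sq_two]
      linear_combination hb

lemma socleQuot_eq_span {t : ℂ} (ht : t ≠ 0) :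
    socleQuot t = Submodule.span ℂ (Set.range
      ![Ideal.Quotient.mk (grIdealIpp t) (X 0 ^ 2 * X 1 ^ 2),
        Ideal.Quotient.mk (grIdealIpp t) (X 0 ^ 2 * X 2 ^ 2)]) := by
  rw [Matrix.range_cons_cons_empty]
  refine le_antisymm ?_ (Submodule.span_le.mpr ?_)
  · intro x hx
    obtain ⟨p, rfl⟩ := Ideal.Quotient.mk_surjective x
    have hp := (mk_mem_socleQuot_iff ht).mp hx
    have h := (mem_grIdealIpp_iff ht).mpr ((leadingConditions_sub_iff hp _ _).mpr ⟨rfl, rfl⟩)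
    rw [neg_one_smul, ← sub_eq_add_neg, ← Ideal.Quotient.eq] at h
    exact Submodule.mem_span_pair.mpr ⟨_, _, h⟩
  · rintro _ (rfl | rfl)
    · exact (mk_mem_socleQuot_iff ht).mpr (socleConditions_sq_mul_sq 0 1)
    · exact (mk_mem_socleQuot_iff ht).mpr (socleConditions_sq_mul_sq 0 2)

lemma linearIndependent_socle {t : ℂ} (ht : t ≠ 0) :
    LinearIndependent ℂ
      ![Ideal.Quotient.mk (grIdealIpp t) (X 0 ^ 2 * X 1 ^ 2),
        Ideal.Quotient.mk (grIdealIpp t) (X 0 ^ 2 * X 2 ^ 2)] := by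
  rw [LinearIndependent.pair_iff]
  intro a b hab
  have h : a • (X 0 ^ 2 * X 1 ^ 2) + b • (X 0 ^ 2 * X 2 ^ 2) + (-1 : ℂ) • 0 ∈ grIdealIpp t := by
    rw [smul_zero, add_zero]
    exact Ideal.Quotient.eq_zero_iff_mem.mp hab
  simpa using (leadingConditions_sub_iff LeadingConditions.zero.socleConditions a b).mp
    ((mem_grIdealIpp_iff ht).mp h)

/-- For `t ≠ 0`, the socle of the finite-dimensional `ℂ`-algebra `ℂ[x₁,x₂,x₃,x₄]/gr I''` has
dimension `2`. -/
theorem stmt11 (t : ℂ) (ht : t ≠ 0) :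
    Module.finrank ℂ (socleQuot t) = 2 := by
  rw [socleQuot_eq_span ht, finrank_span_eq_card (linearIndependent_socle ht), Fintype.card_fin]
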